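/- arXiv:2105.13410 — 2 statements merged into one kernel-verified Lean document; each statement's English description precedes it below -/
import Mathlib

section
/- Let k ∈ ℕ and f, g : (Fin k → ZMod 2) → ZMod 2. On the complex vector space with standard basis e_{(x,y)} indexed by (Fin k → ZMod 2) × ZMod 2, define: U_f e_{(x,y)} = e_{(x, y + f x)}, U_g e_{(x,y)} = e_{(x, y + g x)}, T e_{(x,y)} = ω^y e_{(x,y)} with ω = exp(π i/4) (eigenvalue 1 if y = 0 and ω if y = 1) with inverse T⁻¹, and H the Hadamard on the last qubit. Then applying in sequence (first to last) H, T, U_f, T⁻¹, U_g, T, U_f, T⁻¹, H maps e_{(x,y)} to i^{f x · g x} · (−1)^{y · g x} · e_{(x, y + f x · g x)}. That is, unmatched ancilla-free oracle multiplication (computing U_g only once) implements the oracle for f·g up to a phase depending on the controls and the target. -/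
/-- Standard basis vector of the complex vector space over index type `ι`. -/
noncomputable def e {ι : Type*} [DecidableEq ι] (j : ι) : ι → ℂ := Pi.single j 1

/-- `(−1)^b` for a bit `b`. -/
def m1 (b : ZMod 2) : ℂ := if b = 0 then 1 else -1

/-- `i^b` for a bit `b`. -/
def iPow (b : ZMod 2) : ℂ := if b = 0 then 1 else Complex.I

/-- The primitive eighth root of unity `ω = exp(π i / 4)`. -/
noncomputable def omega : ℂ := Complex.exp (Real.pi * Complex.I / 4)

/-- `ω^b` for a bit `b`. -/
noncomputable def omegaPow (b : ZMod 2) : ℂ := if b = 0 then 1 else omega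

theorem omega_ne_zero : omega ≠ 0 := Complex.exp_ne_zero _

theorem omega_mul_omega : omega * omega = Complex.I := by
  rw [omega, ← Complex.exp_add]
  convert Complex.exp_pi_div_two_mul_I using 2
  ring

theorem omega_inv_mul_inv : omega⁻¹ * omega⁻¹ = -Complex.I := by
  rw [← mul_inv, omega_mul_omega, Complex.inv_I]

theorem sqrt_two_inv_mul_inv : (Real.sqrt 2 : ℂ)⁻¹ * (Real.sqrt 2 : ℂ)⁻¹ = 1 / 2 := by
  rw [← mul_inv, ← Complex.ofReal_mul, Real.mul_self_sqrt zero_le_two]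
  norm_num

/-- unmatched ancilla-free oracle multiplication.  The sequence
`H, T, U_f, T⁻¹, U_g, T, U_f, T⁻¹, H` (first to last) maps `e_{(x,y)}` to
`i^{f x · g x} (−1)^{y · g x} e_{(x, y + f x · g x)}`. -/
theorem unmatched_oracle_multiplication
    (k : ℕ) (f g : (Fin k → ZMod 2) → ZMod 2)
    (Uf Ug T Tinv H : ((Fin k → ZMod 2) × ZMod 2 → ℂ) →ₗ[ℂ]
      ((Fin k → ZMod 2) × ZMod 2 → ℂ))
    (hUf : ∀ (x : Fin k → ZMod 2) (y : ZMod 2), Uf (e (x, y)) = e (x, y + f x))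
    (hUg : ∀ (x : Fin k → ZMod 2) (y : ZMod 2), Ug (e (x, y)) = e (x, y + g x))
    (hT : ∀ (x : Fin k → ZMod 2) (y : ZMod 2), T (e (x, y)) = omegaPow y • e (x, y))
    (hTinv : ∀ (x : Fin k → ZMod 2) (y : ZMod 2),
      Tinv (e (x, y)) = (omegaPow y)⁻¹ • e (x, y))
    (hH : ∀ (x : Fin k → ZMod 2) (y : ZMod 2),
      H (e (x, y)) = ((Real.sqrt 2 : ℂ))⁻¹ • (e (x, 0) + m1 y • e (x, 1))) :
    ∀ (x : Fin k → ZMod 2) (y : ZMod 2),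
      H (Tinv (Uf (T (Ug (Tinv (Uf (T (H (e (x, y)))))))))) =
        (iPow (f x * g x) * m1 (y * g x)) • e (x, y + f x * g x) := by
  intro x y
  have bit_cases : ∀ b : ZMod 2, b = 0 ∨ b = 1 := by decide
  have one_add_one : (1 : ZMod 2) + 1 = 0 := by decide
  have hω := mul_inv_cancel₀ omega_ne_zero
  have hω2 := omega_mul_omega
  have hω2' := omega_inv_mul_inv
  have hs := sqrt_two_inv_mul_inv
  rcases bit_cases (f x) with hf | hf <;> rcases bit_cases (g x) with hg | hg <;>
    rcases bit_cases y with rfl | rfl <;>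
    simp only [hH, hT, hTinv, hUf, hUg, map_smul, map_add, hf, hg, m1, iPow, omegaPow, add_zero,
      zero_add, one_add_one, mul_zero, mul_one, one_ne_zero, if_true, if_false,
      one_smul, inv_one] <;>
    match_scalars <;> grind
end

section
/- On the complex vector space with standard basis e_{(x₁,x₂,x₃,p)} indexed by (ZMod 2)⁴ (three controls and an ancilla p holding the relative-phase triple product), consider for each x = (x₁,x₂,x₃) the state v_x = i^{x₁·x₂} · e_{(x₁,x₂,x₃, x₁·x₂·x₃)} produced by Maslov's relative-phase initialization of a logical AND of three bits. Apply the Hadamard to the ancilla p and, for each measurement outcome z ∈ ZMod 2, take the component with p = z, viewed as the vector w_z in the space with basis e_{(x₁,x₂,x₃)}. Then: (1) w_z = (1/√2) · i^{x₁·x₂} · (−1)^{z·x₁·x₂·x₃} · e_{(x₁,x₂,x₃)}; (2) if z = 0, applying the controlled-S† gate e_{(x₁,x₂,x₃)} ↦ (−i)^{x₁·x₂} e_{(x₁,x₂,x₃)} to w_z yields (1/√2) e_{(x₁,x₂,x₃)}; and (3) if z = 1, applying the doubly-controlled −iZ gate e_{(x₁,x₂,x₃)} ↦ (−i)^{x₁·x₂}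 (−1)^{x₁·x₂·x₃} e_{(x₁,x₂,x₃)} to w_z yields (1/√2) e_{(x₁,x₂,x₃)}. Hence the measurement-assisted termination of Maslov's 3-AND, with these classically-controlled Clifford+T corrections, exactly removes both the temporary value and its relative phase. -/
/-- `(−i)^b` for a bit `b`. -/
def negiPow (b : ZMod 2) : ℂ := if b = 0 then 1 else -Complex.I

/-- State space on the three controls and the ancilla `p`. -/
abbrev V4' := (ZMod 2 × ZMod 2 × ZMod 2 × ZMod 2) → ℂ

/-- State space on the three controls only. -/
abbrev V3' := (ZMod 2 × ZMod 2 × ZMod 2) → ℂ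

theorem m1_mul_self (b : ZMod 2) : m1 b * m1 b = 1 := by
  unfold m1; split_ifs <;> norm_num

theorem negiPow_mul_iPow (b : ZMod 2) : negiPow b * iPow b = 1 := by
  unfold negiPow iPow; split_ifs <;> simp

/-- The component with ancilla value `z` of a product basis vector. -/
theorem e_ancilla_component (x₁ x₂ x₃ p z : ZMod 2) (q : ZMod 2 × ZMod 2 × ZMod 2) :
    (e (x₁, x₂, x₃, p) : V4') (q.1, q.2.1, q.2.2, z) =
      if z = p then (e (x₁, x₂, x₃) : V3') q else 0 := by
  obtain ⟨a, b, c⟩ := q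
  simp only [e, Pi.single_apply, Prod.mk.injEq]
  split_ifs <;> simp_all

/-- The Hadamard amplitude `(-1)^(z p)` at outcome `z` as a sum over the two outcomes. -/
theorem hadamard_amplitude (z p : ZMod 2) :
    ((if z = 0 then 1 else 0) + m1 p * (if z = 1 then 1 else 0) : ℂ) = m1 (z * p) := by
  obtain rfl | rfl : z = 0 ∨ z = 1 := by revert z; decide
  · simp [m1]
  · simp

/-- measurement-assisted termination of Maslov's 3-AND.  Starting
from `v_x = i^{x₁x₂} e_{(x₁,x₂,x₃, x₁x₂x₃)}`, applying the Hadamard to the ancilla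
and taking the component with ancilla value `z` gives
`w_z = (1/√2) i^{x₁x₂} (−1)^{z·x₁x₂x₃} e_{(x₁,x₂,x₃)}`; the controlled-`S†`
correction on outcome `0`, resp. the doubly-controlled `−iZ` correction on outcome
`1`, returns `(1/√2) e_{(x₁,x₂,x₃)}` exactly. -/
theorem maslov_three_and_termination
    (H : V4' →ₗ[ℂ] V4')
    (hH : ∀ x₁ x₂ x₃ p : ZMod 2,
      H (e (x₁, x₂, x₃, p)) =
        ((Real.sqrt 2 : ℂ))⁻¹ • (e (x₁, x₂, x₃, 0) + m1 p • e (x₁, x₂, x₃, 1)))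
    (CSdag CCmiZ : V3' →ₗ[ℂ] V3')
    (hCS : ∀ a b c : ZMod 2, CSdag (e (a, b, c)) = negiPow (a * b) • e (a, b, c))
    (hCC : ∀ a b c : ZMod 2,
      CCmiZ (e (a, b, c)) = (negiPow (a * b) * m1 (a * b * c)) • e (a, b, c)) :
    ∀ x₁ x₂ x₃ : ZMod 2,
      (∀ z : ZMod 2,
        (fun q : ZMod 2 × ZMod 2 × ZMod 2 =>
            H (iPow (x₁ * x₂) • e (x₁, x₂, x₃, x₁ * x₂ * x₃)) (q.1, q.2.1, q.2.2, z)) =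
          ((Real.sqrt 2 : ℂ)⁻¹ * iPow (x₁ * x₂) * m1 (z * x₁ * x₂ * x₃)) •
            e (x₁, x₂, x₃)) ∧
      CSdag (fun q : ZMod 2 × ZMod 2 × ZMod 2 =>
          H (iPow (x₁ * x₂) • e (x₁, x₂, x₃, x₁ * x₂ * x₃)) (q.1, q.2.1, q.2.2, 0)) =
        ((Real.sqrt 2 : ℂ))⁻¹ • e (x₁, x₂, x₃) ∧
      CCmiZ (fun q : ZMod 2 × ZMod 2 × ZMod 2 =>
          H (iPow (x₁ * x₂) • e (x₁, x₂, x₃, x₁ * x₂ * x₃)) (q.1, q.2.1, q.2.2, 1)) =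
        ((Real.sqrt 2 : ℂ))⁻¹ • e (x₁, x₂, x₃) := by
  intro x₁ x₂ x₃
  have component (z : ZMod 2) :
      (fun q : ZMod 2 × ZMod 2 × ZMod 2 =>
          H (iPow (x₁ * x₂) • e (x₁, x₂, x₃, x₁ * x₂ * x₃)) (q.1, q.2.1, q.2.2, z)) =
        ((Real.sqrt 2 : ℂ)⁻¹ * iPow (x₁ * x₂) * m1 (z * x₁ * x₂ * x₃)) •
          e (x₁, x₂, x₃) := by
    funext q
    have hz : z * x₁ * x₂ * x₃ = z * (x₁ * x₂ * x₃) := by ring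
    rw [map_smul, hH, hz, ← hadamard_amplitude z (x₁ * x₂ * x₃)]
    simp only [Pi.smul_apply, Pi.add_apply, smul_eq_mul, e_ancilla_component]
    split_ifs <;> ring
  have hphase := negiPow_mul_iPow (x₁ * x₂)
  have hsign := m1_mul_self (x₁ * x₂ * x₃)
  refine ⟨component, ?_, ?_⟩
  · rw [component, map_smul, hCS, smul_smul]
    congr 1
    simp only [zero_mul, m1, if_true]
    linear_combination (Real.sqrt 2 : ℂ)⁻¹ * hphase
  · rw [component, map_smul, hCC, smul_smul, one_mul]
    congr 1
    linear_combination (Real.sqrt 2 : ℂ)⁻¹ * (m1 (x₁ * x₂ * x₃) * m1 (x₁ * x₂ * x₃)) * hphase +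
      (Real.sqrt 2 : ℂ)⁻¹ * hsign
end
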